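/- For any positive integer k, the subgraph induced in Λ(2,k) by the lattice triangles (lattice polygons with exactly 3 vertices) and the lattice quadrilaterals (lattice polygons with exactly 4 vertices) is connected. -/

import Mathlib

open Set

/-- Points of `ℝ^d`. -/
abbrev Pt (d : ℕ) := Fin d → ℝ

/-- A polytope in `ℝ^d` is the convex hull of a finite set of points. -/
def IsPolytope (d : ℕ) (P : Set (Pt d)) : Prop :=
  ∃ S : Finset (Pt d), P = convexHull ℝ (S : Set (Pt d))

/-- A set is `d`-dimensional (full-dimensional) if its affine hull is all of `ℝ^d`. -/
def FullDim (d : ℕ) (P : Set (Pt d)) : Prop := affineSpan ℝ P = ⊤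

/-- A point `x` can be inserted in `P` when the convex hull of `P ∪ {x}` has as its
vertex set (set of extreme points) exactly the vertex set of `P` together with `x`. -/
def CanInsert (d : ℕ) (P : Set (Pt d)) (x : Pt d) : Prop :=
  Set.extremePoints ℝ (convexHull ℝ (P ∪ {x})) = Set.extremePoints ℝ P ∪ {x}

/-- A vertex `v` of `P` can be deleted from `P` when the convex hull of the remaining
vertices is `d`-dimensional. -/
def CanDelete (d : ℕ) (P : Set (Pt d)) (v : Pt d) : Prop :=
  v ∈ Set.extremePoints ℝ P ∧
    FullDim d (convexHull ℝ (Set.extremePoints ℝ P \ {v}))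

/-- `Q` is obtained from `P` by an insertion move. -/
def InsertMove (d : ℕ) (P Q : Set (Pt d)) : Prop :=
  ∃ x : Pt d, CanInsert d P x ∧ Q = convexHull ℝ (P ∪ {x})

/-- `Q` is obtained from `P` by a deletion move. -/
def DeleteMove (d : ℕ) (P Q : Set (Pt d)) : Prop :=
  ∃ v : Pt d, CanDelete d P v ∧ Q = convexHull ℝ (Set.extremePoints ℝ P \ {v})

/-- Adjacency: one polytope is obtained from the other by inserting a point or
deleting a vertex. -/
def Move (d : ℕ) (P Q : Set (Pt d)) : Prop :=
  InsertMove d P Q ∨ DeleteMove d P Q ∨ InsertMove d Q P ∨ DeleteMove d Q P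

/-- There is a path of at most `n` edges from `P` to `Q` all of whose vertices lie in
the class `C` of polytopes (i.e. `P` and `Q` are at distance at most `n` in the subgraph
induced by `C`). -/
def PathLE (d : ℕ) (C : Set (Set (Pt d))) (P Q : Set (Pt d)) (n : ℕ) : Prop :=
  ∃ (m : ℕ) (f : ℕ → Set (Pt d)), m ≤ n ∧ f 0 = P ∧ f m = Q ∧
    (∀ i ≤ m, f i ∈ C) ∧ ∀ i < m, Move d (f i) (f (i + 1))

/-- The subgraph induced by the class `C` is connected. -/
def ConnectedIn (d : ℕ) (C : Set (Set (Pt d))) : Prop :=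
  ∀ P ∈ C, ∀ Q ∈ C, ∃ n, PathLE d C P Q n

/-- The vertex set of the graph `Γ(d)`: the `d`-dimensional polytopes in `ℝ^d`. -/
def Gamma (d : ℕ) : Set (Set (Pt d)) := {P | IsPolytope d P ∧ FullDim d P}

/-- The number of vertices of a polytope. -/
noncomputable def nVerts (d : ℕ) (P : Set (Pt d)) : ℕ := (Set.extremePoints ℝ P).ncard

/-- A lattice point of `ℝ^d`. -/
def IsLatticePt (d : ℕ) (x : Pt d) : Prop := ∀ i, ∃ z : ℤ, x i = (z : ℝ)

/-- A lattice polytope: all its vertices are lattice points. -/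
def IsLatticePoly (d : ℕ) (P : Set (Pt d)) : Prop :=
  ∀ v ∈ Set.extremePoints ℝ P, IsLatticePt d v

/-- The hypercube `[0,k]^d`. -/
def Cube (d k : ℕ) : Set (Pt d) := {x | ∀ i, x i ∈ Set.Icc (0 : ℝ) (k : ℝ)}

/-- The vertex set of `Λ(d)`: the `d`-dimensional lattice polytopes in `ℝ^d`. -/
def Lambda (d : ℕ) : Set (Set (Pt d)) :=
  {P | IsPolytope d P ∧ FullDim d P ∧ IsLatticePoly d P}

/-- The vertex set of `Λ(d,k)`: the `d`-dimensional lattice polytopes in `[0,k]^d`. -/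
def LambdaK (d k : ℕ) : Set (Set (Pt d)) := {P ∈ Lambda d | P ⊆ Cube d k}

/-- A facet of a polytope `P`: an exposed face of dimension `d-1`. -/
def IsFacet (d : ℕ) (P F : Set (Pt d)) : Prop :=
  IsExposed ℝ P F ∧ F.Nonempty ∧ F ≠ P ∧
    Module.finrank ℝ ↥(vectorSpan ℝ F) = d - 1

/-- `H` is the closed half-space `H_F^-(P)` bounded by the affine hull of the facet `F`
and satisfying `P ∩ H = F`. -/
def BoundingHalfspace (d : ℕ) (P F H : Set (Pt d)) : Prop :=
  ∃ (l : (Pt d) →ₗ[ℝ] ℝ) (c : ℝ), l ≠ 0 ∧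
    H = {x | l x ≤ c} ∧
    (affineSpan ℝ F : Set (Pt d)) = {x | l x = c} ∧
    P ∩ H = F

/-- The cone `C_v(P)`: the intersection of the half-spaces `H_F^-(P)` over all facets
`F` of `P` incident to `v`. -/
def Cone (d : ℕ) (P : Set (Pt d)) (v : Pt d) : Set (Pt d) :=
  {x | ∀ F H : Set (Pt d), IsFacet d P F → v ∈ F → BoundingHalfspace d P F H → x ∈ H}

/-- A set `A` is in convex position: every finite subset of `A` is the vertex set of
a polytope, namely of its own convex hull. -/
def ConvexPosition (d : ℕ) (A : Set (Pt d)) : Prop :=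
  ∀ S : Finset (Pt d), (S : Set (Pt d)) ⊆ A →
    Set.extremePoints ℝ (convexHull ℝ (S : Set (Pt d))) = (S : Set (Pt d))

/-! ### Vertices of planar polygons -/

theorem convexHull_extremePoints_of_isPolytope {d : ℕ} {P : Set (Pt d)} (hP : IsPolytope d P) :
    (extremePoints ℝ P).Finite ∧ convexHull ℝ (extremePoints ℝ P) = P := by
  obtain ⟨S, rfl⟩ := hP
  have hfin : (extremePoints ℝ (convexHull ℝ (S : Set (Pt d)))).Finite :=
    S.finite_toSet.subset extremePoints_convexHull_subset
  refine ⟨hfin, ?_⟩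
  have h := closure_convexHull_extremePoints (S.finite_toSet.isCompact_convexHull ℝ)
    (convex_convexHull ℝ (S : Set (Pt d)))
  rwa [(hfin.isClosed_convexHull ℝ).closure_eq] at h

/-- Points of a finite set that are strictly separated from all the others are the vertices
of its convex hull. -/
theorem extremePoints_convexHull_eq_of_separated {V : Set (Pt 2)} (hV : V.Finite)
    (h : ∀ x ∈ V, ∃ u v w : ℝ, u * x 0 + v * x 1 < w ∧
      ∀ y ∈ V, y ≠ x → w ≤ u * y 0 + v * y 1) :
    extremePoints ℝ (convexHull ℝ V) = V := by
  refine extremePoints_convexHull_subset.antisymm fun x hx => ?_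
  by_contra hne
  obtain ⟨u, v, w, hlt, hle⟩ := h x hx
  have hconv : Convex ℝ {y : Pt 2 | w ≤ u * y 0 + v * y 1} := by
    refine convex_halfSpace_ge (f := fun y : Pt 2 => u * y 0 + v * y 1) ⟨?_, ?_⟩ w
    · intro y z; simp only [Pi.add_apply]; ring
    · intro c y; simp only [Pi.smul_apply, smul_eq_mul]; ring
  have hsub : extremePoints ℝ (convexHull ℝ V) ⊆ {y : Pt 2 | w ≤ u * y 0 + v * y 1} :=
    fun y hy => hle y (extremePoints_convexHull_subset hy) fun hyx => hne (hyx ▸ hy)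
  have hmem : x ∈ convexHull ℝ (extremePoints ℝ (convexHull ℝ V)) := by
    rw [(convexHull_extremePoints_of_isPolytope ⟨hV.toFinset, by simp⟩).2]
    exact subset_convexHull ℝ V hx
  exact absurd (convexHull_min hsub hconv hmem) (not_le.2 hlt)

/-- A full-dimensional subset of the plane is not contained in a line. -/
theorem exists_ne_of_affineSpan_eq_top {V : Set (Pt 2)} (hV : affineSpan ℝ V = ⊤) {u v w : ℝ}
    (huv : u ≠ 0 ∨ v ≠ 0) : ∃ x ∈ V, u * x 0 + v * x 1 ≠ w := by
  by_contra! h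
  have hall (x : Pt 2) : u * x 0 + v * x 1 = w := by
    refine affineSpan_induction (k := ℝ) (s := V) (p := fun x => u * x 0 + v * x 1 = w)
      (hV ▸ AffineSubspace.mem_top ℝ (Pt 2) x) h fun c x y z hx hy hz => ?_
    simp only [vsub_eq_sub, vadd_eq_add, Pi.add_apply, Pi.smul_apply, Pi.sub_apply, smul_eq_mul]
    linear_combination c * (hx - hy) + hz
  have h0 := hall ![0, 0]
  have h1 := hall ![1, 0]
  have h2 := hall ![0, 1]
  simp at h0 h1 h2
  rcases huv with h | h
  · exact h (h1.trans h0.symm)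
  · exact h (h2.trans h0.symm)

/-! ### Lattice points as pairs of integers -/

/-- The lattice point of the plane with given integer coordinates. -/
def latticePt (a : ℤ × ℤ) : Pt 2 := ![(a.1 : ℝ), (a.2 : ℝ)]

@[simp] theorem latticePt_zero (a : ℤ × ℤ) : latticePt a 0 = a.1 := rfl

@[simp] theorem latticePt_one (a : ℤ × ℤ) : latticePt a 1 = a.2 := rfl

theorem latticePt_injective : Function.Injective latticePt := fun a b h => by
  have h0 := congrFun h 0
  have h1 := congrFun h 1
  simp only [latticePt_zero, latticePt_one, Int.cast_inj] at h0 h1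
  exact Prod.ext h0 h1

/-- Twice the signed area of the triangle `abc`. -/
def area (a b c : ℤ × ℤ) : ℤ :=
  (b.1 - a.1) * (c.2 - a.2) - (b.2 - a.2) * (c.1 - a.1)

/-- The polygon spanned by a set of integer pairs. -/
def hull (S : Set (ℤ × ℤ)) : Set (Pt 2) := convexHull ℝ (latticePt '' S)

/-- The integer points of the square `[0,k]²`. -/
def box (k : ℤ) : Set (ℤ × ℤ) := Icc 0 k ×ˢ Icc 0 k

theorem extremePoints_hull_of_separated {S : Set (ℤ × ℤ)} (hS : S.Finite)
    (h : ∀ x ∈ S, ∃ p q, area p q x ≠ 0 ∧ ∀ y ∈ S, y ≠ x → area p q x * area p q y ≤ 0) :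
    extremePoints ℝ (hull S) = latticePt '' S := by
  refine extremePoints_convexHull_eq_of_separated (hS.image _) ?_
  rintro _ ⟨x, hx, rfl⟩
  obtain ⟨p, q, hlt, hle⟩ := h x hx
  refine ⟨(area p q x * (q.2 - p.2) : ℤ), (-area p q x * (q.1 - p.1) : ℤ),
    (area p q x * ((q.2 - p.2) * p.1 - (q.1 - p.1) * p.2) : ℤ), ?_, ?_⟩
  · simp only [latticePt_zero, latticePt_one]
    norm_cast
    have := pow_pos (abs_pos.2 hlt) 2
    rw [sq_abs] at this
    have hx : area p q x = (q.1 - p.1) * (x.2 - p.2) - (q.2 - p.2) * (x.1 - p.1) := rfl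
    linear_combination this + area p q x * hx
  · rintro _ ⟨y, hy, rfl⟩ hne
    simp only [latticePt_zero, latticePt_one]
    norm_cast
    have := hle y hy (ne_of_apply_ne _ hne)
    have hy : area p q y = (q.1 - p.1) * (y.2 - p.2) - (q.2 - p.2) * (y.1 - p.1) := rfl
    linear_combination this - area p q x * hy

theorem affineSpan_latticePt_eq_top {S : Set (ℤ × ℤ)} {a b c : ℤ × ℤ} (ha : a ∈ S) (hb : b ∈ S)
    (hc : c ∈ S) (h : area a b c ≠ 0) : affineSpan ℝ (latticePt '' S) = ⊤ := by
  have mem {x} (hx : x ∈ S) : latticePt x ∈ affineSpan ℝ (latticePt '' S) :=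
    subset_affineSpan ℝ _ (mem_image_of_mem _ hx)
  have hD : (area a b c : ℝ) ≠ 0 := mod_cast h
  refine top_le_iff.1 fun x _ => ?_
  have key := (affineSpan ℝ (latticePt '' S)).smul_vsub_vadd_mem
    (((b.1 - a.1) * (x 1 - a.2) - (b.2 - a.2) * (x 0 - a.1)) / (area a b c : ℝ)) (mem hc) (mem ha)
    ((affineSpan ℝ (latticePt '' S)).smul_vsub_vadd_mem
      (((x 0 - a.1) * (c.2 - a.2) - (x 1 - a.2) * (c.1 - a.1)) / (area a b c : ℝ))
      (mem hb) (mem ha) (mem ha))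
  convert key using 1
  have hE : (area a b c : ℝ) =
    (b.1 - a.1) * (c.2 - a.2) - (b.2 - a.2) * (c.1 - a.1) := by simp [area]
  ext i
  fin_cases i
  all_goals
    simp only [vsub_eq_sub, vadd_eq_add, Pi.add_apply, Pi.smul_apply, Pi.sub_apply, smul_eq_mul,
      Fin.zero_eta, Fin.mk_one, latticePt_zero, latticePt_one]
    field_simp
    rw [hE]
    ring

/-- The class of triangles and quadrilaterals in `Λ(2,k)`. -/
abbrev smallPolygons (k : ℕ) : Set (Set (Pt 2)) :=
  {P ∈ LambdaK 2 k | nVerts 2 P = 3 ∨ nVerts 2 P = 4}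

theorem hull_mem_smallPolygons {k : ℕ} {S : Set (ℤ × ℤ)} {a b c : ℤ × ℤ} (ha : a ∈ S) (hb : b ∈ S)
    (hc : c ∈ S) (h : area a b c ≠ 0) (hbox : S ⊆ box k) (hcard : S.ncard = 3 ∨ S.ncard = 4)
    (hext : extremePoints ℝ (hull S) = latticePt '' S) : hull S ∈ smallPolygons k := by
  have hfin : S.Finite := finite_of_ncard_pos (by omega)
  refine ⟨⟨⟨⟨(hfin.image latticePt).toFinset, by simp [hull]⟩, ?_, ?_⟩, ?_⟩, ?_⟩
  · rw [FullDim, hull, affineSpan_convexHull]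
    exact affineSpan_latticePt_eq_top ha hb hc h
  · rw [IsLatticePoly, hext]
    rintro _ ⟨x, -, rfl⟩ i
    fin_cases i
    exacts [⟨x.1, rfl⟩, ⟨x.2, rfl⟩]
  · have hcube : Cube 2 k = Set.pi univ fun _ => Icc (0 : ℝ) k := by
      ext; simp only [Cube, mem_ofPred_eq, mem_univ_pi]
    refine convexHull_min ?_ (hcube ▸ convex_pi fun _ _ => convex_Icc _ _)
    rintro _ ⟨x, hx, rfl⟩ i
    obtain ⟨⟨h1, h2⟩, h3, h4⟩ := hbox hx
    fin_cases i
    · exact ⟨by simpa using mod_cast h1, by simpa using mod_cast h2⟩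
    · exact ⟨by simpa using mod_cast h3, by simpa using mod_cast h4⟩
  · rwa [nVerts, hext, ncard_image_of_injective _ latticePt_injective]

theorem ncard_triple_of_area_ne_zero {a b c : ℤ × ℤ} (h : area a b c ≠ 0) :
    ({a, b, c} : Set (ℤ × ℤ)).ncard = 3 := by
  refine ncard_eq_three.2 ⟨a, b, c, ?_, ?_, ?_, rfl⟩ <;> rintro rfl <;> apply h <;>
    simp only [area] <;> ring

theorem extremePoints_hull_triangle {a b c : ℤ × ℤ} (h : area a b c ≠ 0) :
    extremePoints ℝ (hull {a, b, c}) = latticePt '' {a, b, c} := by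
  refine extremePoints_hull_of_separated (toFinite _) ?_
  have h1 : area b c a ≠ 0 := by convert h using 1; simp only [area]; ring
  have h2 : area c a b ≠ 0 := by convert h using 1; simp only [area]; ring
  have hz (p q : ℤ × ℤ) : area p q p = 0 ∧ area p q q = 0 := by
    constructor <;> simp only [area] <;> ring
  rintro x (rfl | rfl | rfl)
  · refine ⟨b, c, h1, ?_⟩
    rintro y (rfl | rfl | rfl) hne <;> simp_all
  · refine ⟨c, a, h2, ?_⟩
    rintro y (rfl | rfl | rfl) hne <;> simp_all
  · refine ⟨a, b, h, ?_⟩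
    rintro y (rfl | rfl | rfl) hne <;> simp_all

theorem hull_triangle_mem {k : ℕ} {a b c : ℤ × ℤ} (h : area a b c ≠ 0)
    (hbox : {a, b, c} ⊆ box k) : hull {a, b, c} ∈ smallPolygons k :=
  hull_mem_smallPolygons (a := a) (b := b) (c := c) (by simp) (by simp) (by simp) h hbox
    (Or.inl (ncard_triple_of_area_ne_zero h)) (extremePoints_hull_triangle h)

/-- The segments `ac` and `bd` cross in their relative interiors; equivalently `abcd` is a
strictly convex quadrilateral. -/
def IsConvexQuad (a b c d : ℤ × ℤ) : Prop :=
  0 < area a b c * area a c d ∧ 0 < area b c d * area b d a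

namespace IsConvexQuad

variable {a b c d : ℤ × ℤ}

theorem rotate (h : IsConvexQuad a b c d) : IsConvexQuad b c d a :=
  ⟨h.2, by convert h.1 using 1; simp only [area]; ring⟩

theorem area_ne_zero (h : IsConvexQuad a b c d) : area a b c ≠ 0 :=
  left_ne_zero_of_mul h.1.ne'

theorem ne (h : IsConvexQuad a b c d) : a ≠ b := by
  rintro rfl
  apply h.area_ne_zero
  simp only [area]; ring

theorem ne' (h : IsConvexQuad a b c d) : a ≠ c := by
  rintro rfl
  apply h.area_ne_zero
  simp only [area]; ring

theorem ncard (h : IsConvexQuad a b c d) : ({a, b, c, d} : Set (ℤ × ℤ)).ncard = 4 := by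
  rw [ncard_insert_of_notMem, ncard_triple_of_area_ne_zero h.rotate.area_ne_zero]
  simp only [mem_insert_iff, mem_singleton_iff, not_or]
  exact ⟨h.ne, h.ne', h.rotate.rotate.rotate.ne.symm⟩

theorem separated (h : IsConvexQuad a b c d) : ∃ p q, area p q a ≠ 0 ∧
    ∀ y ∈ ({a, b, c, d} : Set (ℤ × ℤ)), y ≠ a → area p q a * area p q y ≤ 0 := by
  have hz (p q : ℤ × ℤ) : area p q p = 0 ∧ area p q q = 0 := by
    constructor <;> simp only [area] <;> ring
  have hc : area b d c = -area b c d := by simp only [area]; ring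
  refine ⟨b, d, right_ne_zero_of_mul h.2.ne', ?_⟩
  rintro y (rfl | rfl | rfl | rfl) hne
  · exact absurd rfl hne
  · simp [hz]
  · rw [hc]; linarith [h.2]
  · simp [hz]

theorem extremePoints_hull (h : IsConvexQuad a b c d) :
    extremePoints ℝ (hull {a, b, c, d}) = latticePt '' {a, b, c, d} := by
  have hrot (a b c d : ℤ × ℤ) : ({a, b, c, d} : Set (ℤ × ℤ)) = {b, c, d, a} := by
    ext; simp only [mem_insert_iff, mem_singleton_iff]; tauto
  refine extremePoints_hull_of_separated (toFinite _) ?_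
  rintro x (rfl | rfl | rfl | rfl)
  · exact h.separated
  · rw [hrot]; exact h.rotate.separated
  · rw [hrot, hrot]; exact h.rotate.rotate.separated
  · rw [hrot, hrot, hrot]; exact h.rotate.rotate.rotate.separated

theorem hull_mem {k : ℕ} (h : IsConvexQuad a b c d) (hbox : {a, b, c, d} ⊆ box k) :
    hull {a, b, c, d} ∈ smallPolygons k :=
  hull_mem_smallPolygons (a := a) (b := b) (c := c) (by simp) (by simp) (by simp)
    h.area_ne_zero hbox (Or.inr h.ncard) h.extremePoints_hull

end IsConvexQuad

/-! ### Connectivity -/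

/-- Two polygons of the class `C` related by a move. -/
def MoveIn (C : Set (Set (Pt 2))) (P Q : Set (Pt 2)) : Prop := P ∈ C ∧ Q ∈ C ∧ Move 2 P Q

theorem MoveIn.symm {C : Set (Set (Pt 2))} {P Q : Set (Pt 2)} (h : MoveIn C P Q) :
    MoveIn C Q P := by
  obtain ⟨hP, hQ, h⟩ := h
  refine ⟨hQ, hP, ?_⟩
  unfold Move at *
  tauto

instance (C : Set (Set (Pt 2))) : Std.Symm (MoveIn C) := ⟨fun _ _ => MoveIn.symm⟩

theorem exists_pathLE_of_reflTransGen {C : Set (Set (Pt 2))} {P Q : Set (Pt 2)} (hP : P ∈ C)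
    (h : Relation.ReflTransGen (MoveIn C) P Q) : ∃ n, PathLE 2 C P Q n := by
  induction h with
  | refl => exact ⟨0, 0, fun _ => P, le_rfl, rfl, rfl, fun _ _ => hP, by simp⟩
  | @tail Q R _ hQR ih =>
    obtain ⟨-, m, f, -, h0, hm, hC, hmove⟩ := ih
    refine ⟨m + 1, m + 1, fun i => if i ≤ m then f i else R, le_rfl, by simpa, by simp, ?_, ?_⟩
    · intro i _
      by_cases hi : i ≤ m
      · simpa [hi] using hC i hi
      · simpa [hi] using hQR.2.1
    · intro i hi
      rcases (Nat.lt_succ_iff.1 hi).lt_or_eq with hlt | rfl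
      · simpa [hlt.le, Nat.succ_le_iff.2 hlt] using hmove i hlt
      · simpa [hm] using hQR.2.2

/-- `S` and `T` are the vertex sets of the triangles obtained from a convex quadrilateral with
vertices in `box k` by deleting one or the other end of a side. -/
def QuadStep (k : ℤ) (S T : Set (ℤ × ℤ)) : Prop :=
  ∃ a b c d, IsConvexQuad a b c d ∧ {a, b, c, d} ⊆ box k ∧ S = {a, b, c} ∧ T = {b, c, d}

theorem IsConvexQuad.moveIn {k : ℕ} {a b c d : ℤ × ℤ} (h : IsConvexQuad a b c d)
    (hbox : {a, b, c, d} ⊆ box k) :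
    MoveIn (smallPolygons k) (hull {a, b, c, d}) (hull {a, b, c}) := by
  have hsub : ({a, b, c} : Set (ℤ × ℤ)) ⊆ {a, b, c, d} := by
    intro; simp only [mem_insert_iff, mem_singleton_iff]; tauto
  have hdiff : extremePoints ℝ (hull {a, b, c, d}) \ {latticePt d} = latticePt '' {a, b, c} := by
    have hd : latticePt d ∉ latticePt '' ({a, b, c} : Set (ℤ × ℤ)) := by
      rw [latticePt_injective.mem_set_image]
      simp only [mem_insert_iff, mem_singleton_iff, not_or]
      exact ⟨h.rotate.rotate.rotate.ne, h.rotate.ne'.symm, h.rotate.rotate.ne.symm⟩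
    have hi : ({a, b, c, d} : Set (ℤ × ℤ)) = insert d {a, b, c} := by
      ext; simp only [mem_insert_iff, mem_singleton_iff]; tauto
    rw [h.extremePoints_hull, hi, image_insert_eq, insert_sdiff_self_of_notMem hd]
  refine ⟨h.hull_mem hbox, hull_triangle_mem h.area_ne_zero (hsub.trans hbox),
    Or.inr (Or.inl ⟨latticePt d, ⟨?_, ?_⟩, ?_⟩)⟩
  · rw [h.extremePoints_hull]
    exact mem_image_of_mem _ (by simp)
  · rw [hdiff, FullDim, affineSpan_convexHull]
    exact affineSpan_latticePt_eq_top (a := a) (b := b) (c := c) (by simp) (by simp) (by simp)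
      h.area_ne_zero
  · rw [hdiff, hull]

theorem QuadStep.reflTransGen {k : ℕ} {S T : Set (ℤ × ℤ)} (h : QuadStep k S T) :
    Relation.ReflTransGen (MoveIn (smallPolygons k)) (hull S) (hull T) := by
  obtain ⟨a, b, c, d, h, hbox, rfl, rfl⟩ := h
  have hrot : ({b, c, d, a} : Set (ℤ × ℤ)) = {a, b, c, d} := by
    ext; simp only [mem_insert_iff, mem_singleton_iff]; tauto
  have h2 := h.rotate.moveIn (k := k) (by rwa [hrot])
  rw [hrot] at h2
  exact (Relation.ReflTransGen.single (h.moveIn hbox).symm).tail h2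

/-! ### Reduction of lattice triangles to a corner triangle of the square -/

/-- The triangle with vertex set `S` can be transformed into the triangle at the corner `(0, 0)`
of the square, passing through quadrilaterals with vertices in `box k`. -/
def Reducible (k : ℤ) (S : Set (ℤ × ℤ)) : Prop :=
  Relation.EqvGen (QuadStep k) S {(0, k), (0, 0), (k, 0)}

theorem reflTransGen_of_eqvGen {k : ℕ} {S T : Set (ℤ × ℤ)}
    (h : Relation.EqvGen (QuadStep k) S T) :
    Relation.ReflTransGen (MoveIn (smallPolygons k)) (hull S) (hull T) := by
  induction h with
  | rel _ _ h => exact h.reflTransGen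
  | refl => exact .refl
  | symm _ _ _ ih => exact symm ih
  | trans _ _ _ _ _ ih₁ ih₂ => exact ih₁.trans ih₂

theorem IsConvexQuad.of_pos {a b c d : ℤ × ℤ} (h₁ : 0 < area a b c) (h₂ : 0 < area a c d)
    (h₃ : 0 < area b c d) (h₄ : 0 < area b d a) : IsConvexQuad a b c d :=
  ⟨mul_pos h₁ h₂, mul_pos h₃ h₄⟩

theorem IsConvexQuad.reducible {k : ℤ} {a b c d : ℤ × ℤ} (h : IsConvexQuad a b c d)
    (ha : a ∈ box k) (hb : b ∈ box k) (hc : c ∈ box k) (hd : d ∈ box k)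
    (hr : Reducible k {a, b, c}) :
    Reducible k {b, c, d} ∧ Reducible k {c, d, a} ∧ Reducible k {d, a, b} := by
  have step {a b c d : ℤ × ℤ} (h : IsConvexQuad a b c d) (ha : a ∈ box k) (hb : b ∈ box k)
      (hc : c ∈ box k) (hd : d ∈ box k) (hr : Reducible k {a, b, c}) : Reducible k {b, c, d} := by
    refine (Relation.EqvGen.rel _ _ ⟨a, b, c, d, h, ?_, rfl, rfl⟩).symm.trans _ _ _ hr
    simp [insert_subset_iff, *]
  have h1 := step h ha hb hc hd hr
  have h2 := step h.rotate hb hc hd ha h1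
  exact ⟨h1, h2, step h.rotate.rotate hc hd ha hb h2⟩

theorem mem_box {k x y : ℤ} : (x, y) ∈ box k ↔ (0 ≤ x ∧ x ≤ k) ∧ 0 ≤ y ∧ y ≤ k := Iff.rfl

/-- All four triangles spanned by corners of the rectangle `[p,q] × [r,s]` are reducible. -/
def RectReducible (k p q r s : ℤ) : Prop :=
  Reducible k {(p, r), (q, r), (q, s)} ∧ Reducible k {(q, r), (q, s), (p, s)} ∧
    Reducible k {(q, s), (p, s), (p, r)} ∧ Reducible k {(p, s), (p, r), (q, r)}

theorem isConvexQuad_rect {p q r s : ℤ} (hpq : p < q) (hrs : r < s) :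
    IsConvexQuad (p, r) (q, r) (q, s) (p, s) := by
  have := mul_pos (sub_pos.2 hpq) (sub_pos.2 hrs)
  apply IsConvexQuad.of_pos <;> simp only [area] <;> linarith

theorem rectReducible {k p q r s : ℤ} (hp : 0 ≤ p) (hpq : p < q) (hq : q ≤ k) (hr : 0 ≤ r)
    (hrs : r < s) (hs : s ≤ k) : RectReducible k p q r s := by
  have hk : 0 < k := by omega
  have full : RectReducible k 0 k 0 k := by
    have h0 : Reducible k {(0, k), (0, 0), (k, 0)} := Relation.EqvGen.refl _
    obtain ⟨h1, h2, h3⟩ := (isConvexQuad_rect hk hk).rotate.rotate.rotate.reducible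
      (by simp only [mem_box]; omega) (by simp only [mem_box]; omega)
      (by simp only [mem_box]; omega) (by simp only [mem_box]; omega) h0
    exact ⟨h1, h2, h3, h0⟩
  have right : RectReducible k 0 q 0 k := by
    have hx := mul_pos hk hk
    have hy := mul_pos (hp.trans_lt hpq) hk
    have h : IsConvexQuad (0, k) (0, 0) (k, 0) (q, k) := by
      apply IsConvexQuad.of_pos <;> simp only [area] <;> linarith
    obtain ⟨-, -, h0⟩ := h.reducible
      (by simp only [mem_box]; omega) (by simp only [mem_box]; omega)
      (by simp only [mem_box]; omega) (by simp only [mem_box]; omega) full.2.2.2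
    obtain ⟨h1, h2, h3⟩ := (isConvexQuad_rect (hp.trans_lt hpq) hk).rotate.rotate.reducible
      (by simp only [mem_box]; omega) (by simp only [mem_box]; omega)
      (by simp only [mem_box]; omega) (by simp only [mem_box]; omega) h0
    exact ⟨h2, h3, h0, h1⟩
  have left : RectReducible k p q 0 k := by
    have hx := mul_pos (hp.trans_lt hpq) hk
    have hy := mul_pos (sub_pos.2 hpq) hk
    have h : IsConvexQuad (0, 0) (q, 0) (q, k) (p, k) := by
      apply IsConvexQuad.of_pos <;> simp only [area] <;> linarith
    obtain ⟨h0, -, -⟩ := h.reducible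
      (by simp only [mem_box]; omega) (by simp only [mem_box]; omega)
      (by simp only [mem_box]; omega) (by simp only [mem_box]; omega) right.1
    obtain ⟨h1, h2, h3⟩ := (isConvexQuad_rect hpq hk).rotate.reducible
      (by simp only [mem_box]; omega) (by simp only [mem_box]; omega)
      (by simp only [mem_box]; omega) (by simp only [mem_box]; omega) h0
    exact ⟨h3, h0, h1, h2⟩
  have top : RectReducible k p q 0 s := by
    have hx := mul_pos (sub_pos.2 hpq) (hr.trans_lt hrs)
    have hy := mul_pos (sub_pos.2 hpq) hk
    have h : IsConvexQuad (p, k) (p, 0) (q, 0) (q, s) := by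
      apply IsConvexQuad.of_pos <;> simp only [area] <;> linarith
    obtain ⟨h0, -, -⟩ := h.reducible
      (by simp only [mem_box]; omega) (by simp only [mem_box]; omega)
      (by simp only [mem_box]; omega) (by simp only [mem_box]; omega) left.2.2.2
    obtain ⟨h1, h2, h3⟩ := (isConvexQuad_rect hpq (hr.trans_lt hrs)).reducible
      (by simp only [mem_box]; omega) (by simp only [mem_box]; omega)
      (by simp only [mem_box]; omega) (by simp only [mem_box]; omega) h0
    exact ⟨h0, h1, h2, h3⟩
  have hx := mul_pos (sub_pos.2 hpq) (hr.trans_lt hrs)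
  have hy := mul_pos (sub_pos.2 hpq) (sub_pos.2 hrs)
  have h : IsConvexQuad (q, 0) (q, s) (p, s) (p, r) := by
    apply IsConvexQuad.of_pos <;> simp only [area] <;> linarith
  obtain ⟨h0, -, -⟩ := h.reducible
    (by simp only [mem_box]; omega) (by simp only [mem_box]; omega)
    (by simp only [mem_box]; omega) (by simp only [mem_box]; omega) top.2.1
  obtain ⟨h1, h2, h3⟩ := (isConvexQuad_rect hpq hrs).rotate.rotate.reducible
    (by simp only [mem_box]; omega) (by simp only [mem_box]; omega)
    (by simp only [mem_box]; omega) (by simp only [mem_box]; omega) h0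
  exact ⟨h2, h3, h0, h1⟩

theorem Reducible.rotate {k : ℤ} {a b c : ℤ × ℤ} (h : Reducible k {a, b, c}) :
    Reducible k {b, c, a} := by
  rwa [insert_comm, pair_comm a c] at h

theorem Reducible.swap {k : ℤ} {a b c : ℤ × ℤ} (h : Reducible k {a, b, c}) :
    Reducible k {b, a, c} := by
  rwa [insert_comm]

/-- A triangle is reducible if one of its sides is an increasing diagonal of its bounding box. -/
theorem reducible_of_diagonal {k p q r s x y : ℤ} (ha : (p, r) ∈ box k) (hb : (q, s) ∈ box k)
    (hpq : p < q) (hrs : r < s) (hx : x ∈ Icc p q) (hy : y ∈ Icc r s)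
    (h : area (p, r) (q, s) (x, y) ≠ 0) : Reducible k {(p, r), (q, s), (x, y)} := by
  rw [mem_box] at ha hb
  obtain ⟨hx1, hx2⟩ := hx
  obtain ⟨hy1, hy2⟩ := hy
  have hrect := rectReducible ha.1.1 hpq hb.1.2 ha.2.1 hrs hb.2.2
  have hprod := mul_pos (sub_pos.2 hpq) (sub_pos.2 hrs)
  simp only [area] at h
  rcases h.lt_or_gt with h | h
  · have h1 : p < x := by by_contra!; nlinarith
    have h2 : y < s := by by_contra!; nlinarith
    have := mul_pos (sub_pos.2 hpq) (sub_pos.2 h2)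
    have := mul_pos (sub_pos.2 h1) (sub_pos.2 hrs)
    have hquad : IsConvexQuad (q, s) (p, s) (p, r) (x, y) := by
      apply IsConvexQuad.of_pos <;> simp only [area] <;> linarith
    obtain ⟨-, h0, -⟩ := hquad.reducible
      (by simp only [mem_box]; omega) (by simp only [mem_box]; omega)
      (by simp only [mem_box]; omega) (by simp only [mem_box]; omega) hrect.2.2.1
    rwa [pair_comm]
  · have h1 : x < q := by by_contra!; nlinarith
    have h2 : r < y := by by_contra!; nlinarith
    have := mul_pos (sub_pos.2 hpq) (sub_pos.2 h2)
    have := mul_pos (sub_pos.2 h1) (sub_pos.2 hrs)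
    have hquad : IsConvexQuad (p, r) (q, r) (q, s) (x, y) := by
      apply IsConvexQuad.of_pos <;> simp only [area] <;> linarith
    obtain ⟨-, h0, -⟩ := hquad.reducible
      (by simp only [mem_box]; omega) (by simp only [mem_box]; omega)
      (by simp only [mem_box]; omega) (by simp only [mem_box]; omega) hrect.1
    exact h0.rotate.rotate

theorem area_rotate (a b c : ℤ × ℤ) : area b c a = area a b c := by
  simp only [area]; ring

theorem area_swap (a b c : ℤ × ℤ) : area b a c = -area a b c := by
  simp only [area]; ring

theorem reducible_of_monotone {k : ℤ} {a b c : ℤ × ℤ} (ha : a ∈ box k) (hb : b ∈ box k)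
    (hc : c ∈ box k) (hab : a.1 ≤ b.1) (hbc : b.1 ≤ c.1) (hac : a.2 ≤ c.2)
    (h : area a b c ≠ 0) : Reducible k {a, b, c} := by
  have hac1 : a.1 < c.1 := by
    by_contra! hle
    apply h
    simp only [area, show b.1 = a.1 by omega, show c.1 = a.1 by omega]
    ring
  have h' : area a c b ≠ 0 := by
    rw [← area_rotate, area_swap, area_rotate]
    simpa
  obtain ⟨p, r⟩ := a
  obtain ⟨x, y⟩ := b
  obtain ⟨q, s⟩ := c
  dsimp only at hab hbc hac hac1
  have ha' := mem_box.1 ha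
  have hb' := mem_box.1 hb
  have hc' := mem_box.1 hc
  rcases lt_or_ge s y with hsy | hys
  · -- `b` lies above the bounding box of `a` and `c`
    rcases hbc.lt_or_eq with hxq | rfl
    · have hd : (q, y) ∈ box k := by rw [mem_box]; omega
      have hred : Reducible k {(p, r), (q, y), (q, s)} :=
        reducible_of_diagonal ha hd hac1 (by omega) ⟨by omega, le_rfl⟩ ⟨hac, by omega⟩ <| by
          have := mul_pos (sub_pos.2 hac1) (sub_pos.2 hsy)
          apply ne_of_lt; simp only [area]; linarith
      have hquad : IsConvexQuad (p, r) (q, s) (q, y) (x, y) := by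
        have h1 := mul_pos (sub_pos.2 hac1) (sub_pos.2 hsy)
        have h2 := mul_pos (sub_pos.2 hxq) (sub_pos.2 hsy)
        have h3 := mul_pos (sub_pos.2 hxq) (sub_pos.2 (hac.trans_lt hsy))
        have h4 := mul_nonneg (sub_nonneg.2 hab) (sub_nonneg.2 hsy.le)
        apply IsConvexQuad.of_pos <;> simp only [area] <;> linarith
      have h0 := (hquad.reducible ha hc hd hb hred.swap.rotate).2.2
      exact h0.swap
    · exact reducible_of_diagonal ha hb hac1 (by omega) ⟨hab, le_rfl⟩ ⟨hac, hsy.le⟩ h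
  rcases lt_or_ge y r with hyr | hry
  · -- `b` lies below the bounding box of `a` and `c`
    rcases hab.lt_or_eq with hpx | rfl
    · have hd : (p, y) ∈ box k := by rw [mem_box]; omega
      have hred : Reducible k {(p, y), (q, s), (p, r)} :=
        reducible_of_diagonal hd hc hac1 (by omega) ⟨le_rfl, by omega⟩ ⟨hyr.le, hac⟩ <| by
          have := mul_pos (sub_pos.2 hac1) (sub_pos.2 hyr)
          apply ne_of_gt; simp only [area]; linarith
      have hquad : IsConvexQuad (q, s) (p, r) (p, y) (x, y) := by
        have h1 := mul_pos (sub_pos.2 hac1) (sub_pos.2 hyr)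
        have h2 := mul_pos (sub_pos.2 hpx) (sub_pos.2 hyr)
        have h3 := mul_pos (sub_pos.2 hpx) (sub_pos.2 (hyr.trans_le hac))
        have h4 := mul_nonneg (sub_nonneg.2 hbc) (sub_nonneg.2 hyr.le)
        apply IsConvexQuad.of_pos <;> simp only [area] <;> linarith
      have h0 := (hquad.reducible hc ha hd hb hred.rotate).2.2
      exact h0.rotate.rotate
    · refine (reducible_of_diagonal hb hc hac1 (by omega) ⟨le_rfl, hac1.le⟩ ⟨hyr.le, hac⟩
        ?_).rotate.rotate
      rwa [area_rotate]
  · have hrs : r < s := by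
      by_contra! hle
      apply h
      simp only [area, show y = r by omega, show s = r by omega]
      ring
    rw [pair_comm]
    exact reducible_of_diagonal ha hc hac1 hrs ⟨hab, hbc⟩ ⟨hry, hys⟩ h'

/-- Reflection of the square in a horizontal line. -/
def reflectY (k : ℤ) (a : ℤ × ℤ) : ℤ × ℤ := (a.1, k - a.2)

theorem reflectY_mem_box {k : ℤ} {a : ℤ × ℤ} (ha : a ∈ box k) : reflectY k a ∈ box k := by
  obtain ⟨x, y⟩ := a
  rw [mem_box] at ha
  rw [reflectY, mem_box]
  omega

theorem area_reflectY (k : ℤ) (a b c : ℤ × ℤ) :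
    area (reflectY k a) (reflectY k b) (reflectY k c) = -area a b c := by
  simp only [area, reflectY]; ring

theorem QuadStep.image_reflectY {k : ℤ} {S T : Set (ℤ × ℤ)} (h : QuadStep k S T) :
    QuadStep k (reflectY k '' S) (reflectY k '' T) := by
  obtain ⟨a, b, c, d, h, hbox, rfl, rfl⟩ := h
  refine ⟨reflectY k a, reflectY k b, reflectY k c, reflectY k d, ?_, ?_, ?_, ?_⟩
  · simpa only [IsConvexQuad, area_reflectY, neg_mul_neg] using h
  · simp only [insert_subset_iff, singleton_subset_iff] at hbox ⊢
    exact ⟨reflectY_mem_box hbox.1, reflectY_mem_box hbox.2.1, reflectY_mem_box hbox.2.2.1,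
      reflectY_mem_box hbox.2.2.2⟩
  all_goals simp only [image_insert_eq, image_singleton]

theorem eqvGen_image_reflectY {k : ℤ} {S T : Set (ℤ × ℤ)}
    (h : Relation.EqvGen (QuadStep k) S T) :
    Relation.EqvGen (QuadStep k) (reflectY k '' S) (reflectY k '' T) := by
  induction h with
  | rel _ _ h => exact .rel _ _ h.image_reflectY
  | refl => exact .refl _
  | symm _ _ _ ih => exact ih.symm
  | trans _ _ _ _ _ ih₁ ih₂ => exact ih₁.trans _ _ _ ih₂

theorem Reducible.image_reflectY {k : ℤ} (hk : 0 < k) {S : Set (ℤ × ℤ)} (h : Reducible k S) :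
    Reducible k (reflectY k '' S) := by
  refine (eqvGen_image_reflectY h).trans _ _ _ ?_
  have := (rectReducible le_rfl hk le_rfl le_rfl hk le_rfl).2.2.1
  simp only [image_insert_eq, image_singleton, reflectY, sub_self, sub_zero]
  exact this.rotate.swap

theorem reducible_of_ordered {k : ℤ} (hk : 0 < k) {a b c : ℤ × ℤ} (ha : a ∈ box k)
    (hb : b ∈ box k) (hc : c ∈ box k) (hab : a.1 ≤ b.1) (hbc : b.1 ≤ c.1)
    (h : area a b c ≠ 0) : Reducible k {a, b, c} := by
  rcases le_total a.2 c.2 with hac | hca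
  · exact reducible_of_monotone ha hb hc hab hbc hac h
  · have h0 : Reducible k {reflectY k a, reflectY k b, reflectY k c} :=
      reducible_of_monotone (reflectY_mem_box ha) (reflectY_mem_box hb) (reflectY_mem_box hc)
        hab hbc (sub_le_sub_left hca k) (by rwa [area_reflectY, neg_ne_zero])
    simpa only [image_insert_eq, image_singleton, reflectY, sub_sub_cancel] using h0.image_reflectY hk

theorem reducible {k : ℤ} (hk : 0 < k) {a b c : ℤ × ℤ} (ha : a ∈ box k)
    (hb : b ∈ box k) (hc : c ∈ box k) (h : area a b c ≠ 0) : Reducible k {a, b, c} := by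
  have hbac : area b a c ≠ 0 := by rwa [area_swap, neg_ne_zero]
  have rot {a b c : ℤ × ℤ} (h : area a b c ≠ 0) : area b c a ≠ 0 := by rwa [area_rotate]
  rcases le_total a.1 b.1 with h1 | h1 <;> rcases le_total b.1 c.1 with h2 | h2 <;>
    rcases le_total a.1 c.1 with h3 | h3
  · exact reducible_of_ordered hk ha hb hc h1 h2 h
  · exact reducible_of_ordered hk ha hb hc h1 h2 h
  · exact (reducible_of_ordered hk ha hc hb h3 h2 (rot hbac)).rotate.rotate.swap
  · exact (reducible_of_ordered hk hc ha hb h3 h1 (rot (rot h))).rotate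
  · exact (reducible_of_ordered hk hb ha hc h1 h3 hbac).swap
  · exact (reducible_of_ordered hk hb hc ha h2 h3 (rot h)).rotate.rotate
  · exact (reducible_of_ordered hk hc hb ha h2 h1 (rot (rot hbac))).rotate.swap
  · exact (reducible_of_ordered hk hc hb ha h2 h1 (rot (rot hbac))).rotate.swap

/-! ### Connectivity of the graph of triangles and quadrilaterals -/

theorem exists_latticePt_of_isLatticePt {x : Pt 2} (h : IsLatticePt 2 x) :
    ∃ a, latticePt a = x := by
  obtain ⟨u, hu⟩ := h 0
  obtain ⟨v, hv⟩ := h 1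
  refine ⟨(u, v), ?_⟩
  ext i
  fin_cases i
  exacts [hu.symm, hv.symm]

theorem mem_box_of_latticePt_mem_cube {k : ℕ} {a : ℤ × ℤ} (h : latticePt a ∈ Cube 2 k) :
    a ∈ box k := by
  obtain ⟨h1, h2⟩ := h 0
  obtain ⟨h3, h4⟩ := h 1
  simp only [latticePt_zero, latticePt_one] at h1 h2 h3 h4
  exact ⟨⟨mod_cast h1, mod_cast h2⟩, mod_cast h3, mod_cast h4⟩

/-- A polygon in `Λ(2,k)` is the hull of its vertices, three of which span a triangle. -/
theorem exists_hull_of_mem_lambdaK {k : ℕ} {P : Set (Pt 2)} (hP : P ∈ LambdaK 2 k)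
    (hcard : 2 ≤ nVerts 2 P) : ∃ S : Set (ℤ × ℤ), S ⊆ box k ∧ P = hull S ∧
      extremePoints ℝ P = latticePt '' S ∧ S.ncard = nVerts 2 P ∧
      ∃ a ∈ S, ∃ b ∈ S, ∃ c ∈ S, area a b c ≠ 0 := by
  obtain ⟨⟨hpoly, hdim, hlat⟩, hcube⟩ := hP
  have hext : extremePoints ℝ P = latticePt '' (latticePt ⁻¹' extremePoints ℝ P) :=
    (image_preimage_eq_of_subset fun x hx => exists_latticePt_of_isLatticePt (hlat x hx)).symm
  have hhull := (convexHull_extremePoints_of_isPolytope hpoly).2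
  have hn : (latticePt ⁻¹' extremePoints ℝ P).ncard = nVerts 2 P := by
    rw [nVerts, hext, ncard_image_of_injective _ latticePt_injective,
      preimage_image_eq _ latticePt_injective]
  refine ⟨latticePt ⁻¹' extremePoints ℝ P,
    fun a ha => mem_box_of_latticePt_mem_cube (hcube (extremePoints_subset ha)), ?_, hext, hn, ?_⟩
  · rw [hull, ← hext, hhull]
  · obtain ⟨a, b, ha, hb, hab⟩ := (one_lt_ncard_iff (finite_of_ncard_pos (by omega))).1 (hn ▸ hcard)
    have htop : affineSpan ℝ (extremePoints ℝ P) = ⊤ := by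
      rw [← affineSpan_convexHull, hhull]; exact hdim
    have hne : ((a.2 - b.2 : ℤ) : ℝ) ≠ 0 ∨ ((b.1 - a.1 : ℤ) : ℝ) ≠ 0 := by
      by_contra! h
      norm_cast at h
      exact hab (Prod.ext (by omega) (by omega))
    obtain ⟨x, hx, hxne⟩ := exists_ne_of_affineSpan_eq_top htop hne
      (w := ((a.2 - b.2) * a.1 + (b.1 - a.1) * a.2 : ℤ))
    rw [hext] at hx
    obtain ⟨c, hc, rfl⟩ := hx
    refine ⟨a, ha, b, hb, c, hc, fun h => hxne ?_⟩
    simp only [latticePt_zero, latticePt_one]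
    norm_cast
    simp only [area] at h
    linear_combination h

/-- Every triangle or quadrilateral is connected to a triangle. -/
theorem exists_triangle_of_mem_smallPolygons {k : ℕ} {P : Set (Pt 2)} (hP : P ∈ smallPolygons k) :
    ∃ a b c, area a b c ≠ 0 ∧ {a, b, c} ⊆ box k ∧
      Relation.ReflTransGen (MoveIn (smallPolygons k)) P (hull {a, b, c}) := by
  have hcard : nVerts 2 P = 3 ∨ nVerts 2 P = 4 := hP.2
  obtain ⟨S, hbox, rfl, hext, hn, a, ha, b, hb, c, hc, h⟩ :=
    exists_hull_of_mem_lambdaK hP.1 (by omega)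
  have h3 := ncard_triple_of_area_ne_zero h
  have hsub : {a, b, c} ⊆ S := by simp [insert_subset_iff, *]
  have hfin : S.Finite := finite_of_ncard_pos (by omega)
  refine ⟨a, b, c, h, hsub.trans hbox, ?_⟩
  rcases hcard with hcard | hcard
  · rw [eq_of_subset_of_ncard_le hsub (by omega) hfin]
  · have hd := ncard_sdiff hsub
    rw [hn, hcard, h3] at hd
    obtain ⟨d, hd⟩ := ncard_eq_one.1 hd
    have hdS : d ∈ S := (hd.symm ▸ mem_singleton d : d ∈ S \ {a, b, c}).1
    have hS : S \ {d} = {a, b, c} := by rw [← hd, sdiff_sdiff_cancel_left hsub]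
    have hdiff : extremePoints ℝ (hull S) \ {latticePt d} = latticePt '' {a, b, c} := by
      rw [hext, ← image_singleton, ← image_sdiff latticePt_injective, hS]
    refine .single ⟨hP, hull_triangle_mem h (hsub.trans hbox),
      Or.inr (Or.inl ⟨latticePt d, ⟨?_, ?_⟩, ?_⟩)⟩
    · rw [hext]
      exact mem_image_of_mem _ hdS
    · rw [hdiff, FullDim, affineSpan_convexHull]
      exact affineSpan_latticePt_eq_top (a := a) (b := b) (c := c) (by simp) (by simp) (by simp) h
    · rw [hdiff, hull]

/-- the subgraph induced in `Λ(2,k)` by the lattice triangles and the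
lattice quadrilaterals is connected. -/
theorem stmt_10 (k : ℕ) (hk : 1 ≤ k) :
    ConnectedIn 2 {P ∈ LambdaK 2 k | nVerts 2 P = 3 ∨ nVerts 2 P = 4} := by
  have key (P) (hP : P ∈ smallPolygons k) : Relation.ReflTransGen (MoveIn (smallPolygons k)) P
      (hull {(0, (k : ℤ)), (0, 0), ((k : ℤ), 0)}) := by
    obtain ⟨a, b, c, h, hbox, hconn⟩ := exists_triangle_of_mem_smallPolygons hP
    simp only [insert_subset_iff, singleton_subset_iff] at hbox
    exact hconn.trans (reflTransGen_of_eqvGen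
      (reducible (mod_cast hk) hbox.1 hbox.2.1 hbox.2.2 h))
  intro P hP Q hQ
  exact exists_pathLE_of_reflTransGen hP ((key P hP).trans (symm (key Q hQ)))
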